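/- Let q ∈ ℂ with 0 < |q| < 1 and x ∈ ℂ* with x not an integral power of q. Then (1/j(q;q²)) · Σ_{n ∈ ℤ} (-1)^n q^{n²+n} / (1 - x q^n) = -x⁻¹ · m(x⁻² q, q², x), where m(x,q,z) := (1/j(z;q)) · Σ_{r ∈ ℤ} (-1)^r q^{r(r-1)/2} z^r / (1 - q^{r-1} x z) and j(z;q) := (z;q)_∞(q/z;q)_∞(q;q)_∞. -/

import Mathlib

noncomputable def qPoch (x q : ℂ) : ℂ := ∏' k : ℕ, (1 - x * q ^ k)

noncomputable def jP (z q : ℂ) : ℂ := qPoch z q * qPoch (q / z) q * qPoch q q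

noncomputable def mAL (x q z : ℂ) : ℂ :=
  (1 / jP z q) * ∑' r : ℤ, ((-1 : ℂ) ^ r * q ^ (r * (r - 1) / 2) * z ^ r) /
    (1 - q ^ (r - 1) * x * z)

open Filter Topology Complex

lemma summable_zpow_sq_mul_pow_natAbs {ρ R : ℝ} (h0 : 0 < ρ) (h1 : ρ < 1) (hR : 0 < R) :
    Summable fun n : ℤ => ρ ^ (n ^ 2) * R ^ n.natAbs := by
  have hT : 0 < -Real.log ρ / Real.pi :=
    div_pos (neg_pos.2 (Real.log_neg h0 h1)) Real.pi_pos
  refine (summable_pow_mul_jacobiTheta₂_term_bound (Real.log R / (2 * Real.pi)) hT 0).congr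
    fun n => ?_
  have e1 : ρ ^ (n ^ 2) = Real.exp (Real.log ρ * (n : ℝ) ^ 2) := by
    rw [← Real.rpow_intCast, Real.rpow_def_of_pos h0]; push_cast; rfl
  have e2 : R ^ n.natAbs = Real.exp (Real.log R * |(n : ℝ)|) := by
    rw [← Real.rpow_natCast, Real.rpow_def_of_pos hR, Nat.cast_natAbs]; push_cast; rfl
  rw [e1, e2, ← Real.exp_add, pow_zero, one_mul]
  congr 1
  have := Real.pi_ne_zero
  push_cast
  field_simp
  ring

lemma norm_zpow_le_pow_natAbs {x : ℂ} {R : ℝ} (h : ‖x‖ ≤ R) (h' : ‖x⁻¹‖ ≤ R) (n : ℤ) :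
    ‖x ^ n‖ ≤ R ^ n.natAbs := by
  rcases le_total 0 n with hn | hn
  · lift n to ℕ using hn
    simpa using pow_le_pow_left₀ (norm_nonneg _) h n
  · obtain ⟨m, rfl⟩ : ∃ m : ℕ, n = -m := ⟨n.natAbs, by omega⟩
    have := pow_le_pow_left₀ (norm_nonneg _) h' m
    simpa using this

/-- The `n`-th term of the theta series `∑ (-1)^n q^(n(n-1)) x^n` of base `q²`. -/
noncomputable def thetaTerm (q x : ℂ) (n : ℤ) : ℂ := (-1) ^ n * q ^ (n * (n - 1)) * x ^ n

noncomputable def thetaSeries (q x : ℂ) : ℂ := ∑' n : ℤ, thetaTerm q x n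

/-- A majorant of `thetaTerm q x` for `‖q‖ = ρ` and `‖x‖, ‖x⁻¹‖ ≤ R`. -/
noncomputable def thetaBound (ρ R : ℝ) (n : ℤ) : ℝ := ρ ^ (n ^ 2) * (R / ρ) ^ n.natAbs

lemma summable_thetaBound {ρ R : ℝ} (h0 : 0 < ρ) (h1 : ρ < 1) (hR : 0 < R) :
    Summable (thetaBound ρ R) :=
  summable_zpow_sq_mul_pow_natAbs h0 h1 (div_pos hR h0)

lemma thetaTerm_add_one {q x : ℂ} (hq0 : q ≠ 0) (hx : x ≠ 0) (n : ℤ) :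
    thetaTerm q x (n + 1) = -x * q ^ (2 * n) * thetaTerm q x n := by
  rw [thetaTerm, thetaTerm, show (n + 1) * (n + 1 - 1) = n * (n - 1) + 2 * n by ring,
    zpow_add₀ hq0, zpow_add_one₀ hx, zpow_add_one₀ (by norm_num)]
  ring

lemma thetaTerm_mul {q x : ℂ} (y : ℂ) (n : ℤ) :
    thetaTerm q (y * x) n = y ^ n * thetaTerm q x n := by
  rw [thetaTerm, thetaTerm, mul_zpow]; ring

lemma norm_thetaTerm_le {q x : ℂ} {R : ℝ} (hq0 : q ≠ 0) (hq : ‖q‖ < 1) (h : ‖x‖ ≤ R)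
    (h' : ‖x⁻¹‖ ≤ R) (n : ℤ) : ‖thetaTerm q x n‖ ≤ thetaBound ‖q‖ R n := by
  have hρ : 0 < ‖q‖ := norm_pos_iff.2 hq0
  have e : thetaTerm q x n = q ^ (n ^ 2) * (-x / q) ^ n := by
    rw [thetaTerm, show n * (n - 1) = n ^ 2 - n by ring, zpow_sub₀ hq0, div_zpow, neg_eq_neg_one_mul x,
      mul_zpow]
    ring
  rw [e, norm_mul, norm_zpow, thetaBound]
  gcongr
  apply norm_zpow_le_pow_natAbs
  · rw [norm_div, norm_neg]; gcongr
  · rw [inv_div, div_eq_mul_inv, norm_mul, inv_neg, norm_neg, div_eq_mul_inv, mul_comm]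
    have : 1 ≤ ‖q‖⁻¹ := (one_le_inv₀ hρ).2 hq.le
    have : ‖q‖ ≤ ‖q‖⁻¹ := hq.le.trans this
    gcongr
    exact (norm_nonneg _).trans h

lemma exists_norm_le_and_norm_inv_le {K : Set ℂ} (hK : K ⊆ {0}ᶜ) (hc : IsCompact K) :
    ∃ R : ℝ, 0 < R ∧ ∀ x ∈ K, ‖x‖ ≤ R ∧ ‖x⁻¹‖ ≤ R := by
  obtain ⟨a, ha⟩ := hc.exists_bound_of_continuousOn (f := fun x => x) continuousOn_id
  obtain ⟨b, hb⟩ := hc.exists_bound_of_continuousOn (f := fun x => x⁻¹)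
    (continuousOn_inv₀.mono hK)
  refine ⟨max 1 (max a b), by positivity, fun x hx => ⟨(ha x hx).trans (by simp),
    (hb x hx).trans (by simp)⟩⟩

lemma summable_thetaTerm {q x : ℂ} (hq0 : q ≠ 0) (hq : ‖q‖ < 1) (hx : x ≠ 0) :
    Summable (thetaTerm q x) := by
  obtain ⟨R, hR, h⟩ := exists_norm_le_and_norm_inv_le (K := {x}) (by simpa using hx.symm) (by simp)
  exact (summable_thetaBound (norm_pos_iff.2 hq0) hq hR).of_norm_bounded
    (norm_thetaTerm_le hq0 hq (h x rfl).1 (h x rfl).2)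

lemma thetaSeries_sq_mul {q x : ℂ} (hq0 : q ≠ 0) (hx : x ≠ 0) :
    thetaSeries q (q ^ 2 * x) = -x⁻¹ * thetaSeries q x := by
  rw [thetaSeries, thetaSeries, ← tsum_mul_left,
    ← (Equiv.addRight (1 : ℤ)).tsum_eq (fun n => -x⁻¹ * thetaTerm q x n)]
  refine tsum_congr fun n => ?_
  simp only [Equiv.coe_addRight]
  rw [thetaTerm_add_one hq0 hx, thetaTerm_mul, zpow_mul, zpow_ofNat]
  field_simp

/-! ### The Jacobi triple product -/

/-- The reciprocal `1 / (p; p)_n`, extended by zero to negative `n`. -/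
noncomputable def invPoch (p : ℂ) (n : ℤ) : ℂ :=
  if 0 ≤ n then (∏ k ∈ Finset.range n.toNat, (1 - p * p ^ k))⁻¹ else 0

lemma one_sub_mul_pow_ne_zero {p : ℂ} (hp : ‖p‖ < 1) (k : ℕ) : 1 - p * p ^ k ≠ 0 := by
  intro h
  have h1 : ‖p ^ (k + 1)‖ = 1 := by
    rw [pow_succ', ← sub_eq_zero.1 h, norm_one]
  rw [norm_pow] at h1
  exact (pow_lt_one₀ (norm_nonneg _) hp (by omega)).ne h1

lemma invPoch_sub_one {p : ℂ} (hp : ‖p‖ < 1) (n : ℤ) :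
    invPoch p (n - 1) = (1 - p ^ n) * invPoch p n := by
  rcases lt_trichotomy n 0 with h | rfl | h
  · rw [invPoch, invPoch, if_neg (by omega), if_neg (by omega), mul_zero]
  · simp [invPoch]
  · obtain ⟨m, rfl⟩ : ∃ m : ℕ, n = m + 1 := ⟨(n - 1).toNat, by omega⟩
    rw [invPoch, invPoch, if_pos (by omega), if_pos (by omega),
      show ((m : ℤ) + 1 - 1).toNat = m by omega, show ((m : ℤ) + 1).toNat = m + 1 by omega,
      Finset.prod_range_succ]
    have := one_sub_mul_pow_ne_zero hp m
    rw [mul_inv, show p ^ ((m : ℤ) + 1) = p * p ^ m by rw [← pow_succ']; norm_cast]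
    field_simp

lemma multipliable_qPoch (x : ℂ) {p : ℂ} (hp : ‖p‖ < 1) :
    Multipliable fun k : ℕ => 1 - x * p ^ k := by
  simp_rw [sub_eq_add_neg]
  apply multipliable_one_add_of_summable
  simpa using (summable_geometric_of_lt_one (norm_nonneg _) hp).mul_left ‖x‖

lemma qPoch_ne_zero {x p : ℂ} (hp : ‖p‖ < 1) (h : ∀ k : ℕ, x * p ^ k ≠ 1) : qPoch x p ≠ 0 := by
  rw [qPoch]
  simp_rw [sub_eq_add_neg]
  apply tprod_one_add_ne_zero_of_summable
  · intro k hk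
    exact h k (by linear_combination -hk)
  · simpa using (summable_geometric_of_lt_one (norm_nonneg _) hp).mul_left ‖x‖

lemma qPoch_self_ne_zero {p : ℂ} (hp : ‖p‖ < 1) : qPoch p p ≠ 0 :=
  qPoch_ne_zero hp fun k h => one_sub_mul_pow_ne_zero hp k (by rw [h, sub_self])

lemma tendsto_invPoch {p : ℂ} (hp : ‖p‖ < 1) :
    Tendsto (invPoch p) atTop (𝓝 (qPoch p p)⁻¹) := by
  have hN : Tendsto Int.toNat atTop atTop := tendsto_atTop.2 fun b => by
    filter_upwards [eventually_ge_atTop (b : ℤ)] with n hn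
    omega
  have h := ((multipliable_qPoch p hp).tendsto_prod_tprod_nat.inv₀ (qPoch_self_ne_zero hp)).comp hN
  refine h.congr' ?_
  filter_upwards [eventually_ge_atTop 0] with n hn
  simp [invPoch, hn]

lemma exists_norm_invPoch_le {p : ℂ} (hp : ‖p‖ < 1) : ∃ B : ℝ, ∀ n, ‖invPoch p n‖ ≤ B := by
  have h : Tendsto (fun n : ℕ => invPoch p n) atTop (𝓝 (qPoch p p)⁻¹) :=
    (tendsto_invPoch hp).comp tendsto_natCast_atTop_atTop
  obtain ⟨B, hB⟩ := h.norm.bddAbove_range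
  refine ⟨B, fun n => ?_⟩
  rcases le_or_gt 0 n with hn | hn
  · lift n to ℕ using hn
    exact hB ⟨n, rfl⟩
  · rw [invPoch, if_neg hn.not_ge, norm_zero]
    exact (norm_nonneg _).trans (hB ⟨0, rfl⟩)

lemma thetaTerm_mul_invPoch_step_left {q x : ℂ} (hq0 : q ≠ 0) (hq : ‖q ^ 2‖ < 1) (hx : x ≠ 0)
    (M N r : ℤ) :
    (1 - (q ^ 2) ^ (M + N + 1)) *
        (thetaTerm q x r * (invPoch (q ^ 2) (N + r) * invPoch (q ^ 2) (M + 1 - r))) =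
      thetaTerm q x r * (invPoch (q ^ 2) (N + r) * invPoch (q ^ 2) (M - r)) +
      -x * (q ^ 2) ^ M * (thetaTerm q x (r - 1) *
        (invPoch (q ^ 2) (N + (r - 1)) * invPoch (q ^ 2) (M - (r - 1)))) := by
  have hp0 : q ^ 2 ≠ 0 := pow_ne_zero _ hq0
  have h1 := invPoch_sub_one hq (N + r)
  have h2 := invPoch_sub_one hq (M + 1 - r)
  have h3 := thetaTerm_add_one hq0 hx (r - 1)
  rw [zpow_mul, zpow_ofNat, sub_add_cancel, zpow_sub_one₀ hp0] at h3
  rw [show M + 1 - r - 1 = M - r by ring, zpow_sub₀ hp0, zpow_add_one₀ hp0] at h2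
  rw [zpow_add₀ hp0] at h1
  rw [show N + (r - 1) = N + r - 1 by ring, show M - (r - 1) = M + 1 - r by ring, h1, h2, h3,
    zpow_add_one₀ hp0, zpow_add₀ hp0]
  have := zpow_ne_zero r hp0
  field_simp
  ring

lemma thetaTerm_mul_invPoch_step_right {q x : ℂ} (hq0 : q ≠ 0) (hq : ‖q ^ 2‖ < 1) (hx : x ≠ 0)
    (M N r : ℤ) :
    (1 - (q ^ 2) ^ (M + N + 1)) *
        (thetaTerm q x r * (invPoch (q ^ 2) (N + 1 + r) * invPoch (q ^ 2) (M - r))) =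
      thetaTerm q x r * (invPoch (q ^ 2) (N + r) * invPoch (q ^ 2) (M - r)) +
      -(q ^ 2 / x) * (q ^ 2) ^ N * (thetaTerm q x (r + 1) *
        (invPoch (q ^ 2) (N + (r + 1)) * invPoch (q ^ 2) (M - (r + 1)))) := by
  have hp0 : q ^ 2 ≠ 0 := pow_ne_zero _ hq0
  have h1 := invPoch_sub_one hq (N + 1 + r)
  have h2 := invPoch_sub_one hq (M - r)
  have h3 := thetaTerm_add_one hq0 hx r
  rw [zpow_mul, zpow_ofNat] at h3
  rw [zpow_sub₀ hp0] at h2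
  rw [show N + 1 + r - 1 = N + r by ring, zpow_add₀ hp0, zpow_add_one₀ hp0] at h1
  rw [show N + (r + 1) = N + 1 + r by ring, show M - (r + 1) = M - r - 1 by ring, h1, h2, h3,
    zpow_add_one₀ hp0, zpow_add₀ hp0]
  have := zpow_ne_zero r hp0
  field_simp
  ring

/-- A finite form of the Jacobi triple product, equivalent to the `q`-binomial theorem. -/
lemma hasSum_finite_triple_product {q x : ℂ} (hq0 : q ≠ 0) (hq : ‖q ^ 2‖ < 1) (hx : x ≠ 0)
    (M N : ℕ) :
    HasSum (fun r : ℤ => thetaTerm q x r * (invPoch (q ^ 2) (N + r) * invPoch (q ^ 2) (M - r)))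
      ((∏ k ∈ Finset.range M, (1 - x * (q ^ 2) ^ k)) *
        (∏ k ∈ Finset.range N, (1 - q ^ 2 / x * (q ^ 2) ^ k)) *
        invPoch (q ^ 2) (M + N)) := by
  have hne : ∀ M N : ℕ, (1 - (q ^ 2) ^ ((M : ℤ) + N + 1)) ≠ 0 := fun M N => by
    have := one_sub_mul_pow_ne_zero hq (M + N)
    rw [← pow_succ'] at this
    exact_mod_cast this
  have key : ∀ M N : ℕ, invPoch (q ^ 2) ((M : ℤ) + N) =
      (1 - (q ^ 2) ^ ((M : ℤ) + N + 1)) * invPoch (q ^ 2) ((M : ℤ) + N + 1) := fun M N => by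
    rw [← invPoch_sub_one hq, add_sub_cancel_right]
  induction N with
  | zero =>
    induction M with
    | zero =>
      convert hasSum_single (0 : ℤ) fun r hr => ?_ using 1
      · simp [thetaTerm, invPoch]
      · rcases lt_or_gt_of_ne hr with h | h
        · simp [invPoch, h.not_ge]
        · simp [invPoch, h.not_ge]
    | succ M ih =>
      have h := ih.add (((Equiv.subRight (1 : ℤ)).hasSum_iff.2 ih).mul_left (-x * (q ^ 2) ^ M))
      rw [← hasSum_mul_left_iff (hne M 0)]
      convert h using 1
      · rfl
      · ext r
        exact_mod_cast thetaTerm_mul_invPoch_step_left hq0 hq hx M (0 : ℕ) r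
      · rw [Finset.prod_range_succ, key M 0,
          show ((M + 1 : ℕ) : ℤ) + (0 : ℕ) = (M : ℤ) + (0 : ℕ) + 1 by push_cast; ring]
        ring
  | succ N ih =>
    have h := ih.add (((Equiv.addRight (1 : ℤ)).hasSum_iff.2 ih).mul_left
      (-(q ^ 2 / x) * (q ^ 2) ^ N))
    rw [← hasSum_mul_left_iff (hne M N)]
    convert h using 1
    · rfl
    · ext r
      exact_mod_cast thetaTerm_mul_invPoch_step_right hq0 hq hx M N r
    · rw [Finset.prod_range_succ, key M N,
        show (M : ℤ) + ((N + 1 : ℕ) : ℤ) = (M : ℤ) + N + 1 by push_cast; ring]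
      ring

/-- The Jacobi triple product identity. -/
theorem jP_eq_thetaSeries {q x : ℂ} (hq0 : q ≠ 0) (hq : ‖q‖ < 1) (hx : x ≠ 0) :
    jP x (q ^ 2) = thetaSeries q x := by
  have hp : ‖q ^ 2‖ < 1 := by
    rw [norm_pow]; exact pow_lt_one₀ (norm_nonneg _) hq two_ne_zero
  obtain ⟨B, hB⟩ := exists_norm_invPoch_le hp
  have hB0 : 0 ≤ B := (norm_nonneg _).trans (hB 0)
  set c := qPoch (q ^ 2) (q ^ 2) with hc
  have hc0 : c ≠ 0 := qPoch_self_ne_zero hp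
  have lim1 : Tendsto (fun n : ℕ => ∑' r : ℤ, thetaTerm q x r *
      (invPoch (q ^ 2) (n + r) * invPoch (q ^ 2) (n - r))) atTop
      (𝓝 (∑' r : ℤ, thetaTerm q x r * (c⁻¹ * c⁻¹))) := by
    refine tendsto_tsum_of_dominated_convergence
      ((summable_thetaTerm hq0 hq hx).norm.mul_right (B * B)) (fun r => ?_)
      (Eventually.of_forall fun n r => ?_)
    · refine (Tendsto.mul ?_ ?_).const_mul _
      · exact (tendsto_invPoch hp).comp
          (tendsto_atTop_add_const_right _ r tendsto_natCast_atTop_atTop)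
      · exact (tendsto_invPoch hp).comp
          (tendsto_atTop_add_const_right _ (-r) tendsto_natCast_atTop_atTop)
    · rw [norm_mul, norm_mul]
      gcongr <;> apply hB
  have lim2 : Tendsto (fun n : ℕ => (∏ k ∈ Finset.range n, (1 - x * (q ^ 2) ^ k)) *
        (∏ k ∈ Finset.range n, (1 - q ^ 2 / x * (q ^ 2) ^ k)) *
        invPoch (q ^ 2) (n + n)) atTop
      (𝓝 (qPoch x (q ^ 2) * qPoch (q ^ 2 / x) (q ^ 2) * c⁻¹)) := by
    refine Tendsto.mul (Tendsto.mul ?_ ?_) ?_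
    · exact (multipliable_qPoch _ hp).tendsto_prod_tprod_nat
    · exact (multipliable_qPoch _ hp).tendsto_prod_tprod_nat
    · exact (tendsto_invPoch hp).comp
        (tendsto_natCast_atTop_atTop.atTop_add_atTop tendsto_natCast_atTop_atTop)
  simp_rw [fun n : ℕ => (hasSum_finite_triple_product hq0 hp hx n n).tsum_eq] at lim1
  have h := tendsto_nhds_unique lim2 lim1
  rw [tsum_mul_right, ← thetaSeries] at h
  rw [jP, ← hc]
  field_simp at h
  exact h

lemma thetaSeries_zpow_two_mul {q : ℂ} (hq0 : q ≠ 0) (hq : ‖q‖ < 1) (m : ℤ) :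
    thetaSeries q (q ^ (2 * m)) = 0 := by
  have step : ∀ m : ℤ, thetaSeries q (q ^ (2 * (m + 1))) =
      -(q ^ (2 * m))⁻¹ * thetaSeries q (q ^ (2 * m)) := fun m => by
    rw [← thetaSeries_sq_mul hq0 (zpow_ne_zero _ hq0), mul_add, zpow_add₀ hq0, mul_comm]
    norm_cast
  induction m using Int.induction_on with
  | zero =>
    have h : qPoch 1 (q ^ 2) = 0 := tprod_of_exists_eq_zero ⟨0, by simp⟩
    rw [mul_zero, zpow_zero, ← jP_eq_thetaSeries hq0 hq one_ne_zero, jP, h, zero_mul, zero_mul]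
  | succ m ih => rw [step, ih, mul_zero]
  | pred m ih =>
    have h := step (-m - 1)
    rw [sub_add_cancel, ih] at h
    exact (mul_eq_zero.1 h.symm).resolve_left
      (neg_ne_zero.2 (inv_ne_zero (zpow_ne_zero _ hq0)))

lemma thetaSeries_ne_zero {q x : ℂ} (hq0 : q ≠ 0) (hq : ‖q‖ < 1) (hx : x ≠ 0)
    (h : ∀ m : ℤ, x ≠ q ^ (2 * m)) : thetaSeries q x ≠ 0 := by
  have hp : ‖q ^ 2‖ < 1 := by
    rw [norm_pow]; exact pow_lt_one₀ (norm_nonneg _) hq two_ne_zero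
  rw [← jP_eq_thetaSeries hq0 hq hx, jP]
  refine mul_ne_zero (mul_ne_zero (qPoch_ne_zero hp fun k hk => h (-k) ?_)
    (qPoch_ne_zero hp fun k hk => h (k + 1) ?_)) (qPoch_self_ne_zero hp)
  · rw [mul_neg, zpow_neg, zpow_mul]
    exact eq_inv_of_mul_eq_one_left (mod_cast hk)
  · rw [zpow_mul]
    field_simp at hk
    rw [← hk, ← pow_succ']
    norm_cast

lemma differentiableOn_thetaTerm (q : ℂ) (n : ℤ) :
    DifferentiableOn ℂ (fun x => thetaTerm q x n) {0}ᶜ := fun _ hx =>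
  ((differentiableAt_zpow.2 (Or.inl hx)).const_mul _).differentiableWithinAt

lemma differentiableOn_thetaSeries {q : ℂ} (hq0 : q ≠ 0) (hq : ‖q‖ < 1) :
    DifferentiableOn ℂ (thetaSeries q) {0}ᶜ := by
  refine SummableLocallyUniformlyOn.differentiableOn (f := fun n x => thetaTerm q x n)
    isOpen_compl_singleton (SummableLocallyUniformlyOn_of_locally_bounded isOpen_compl_singleton
      fun K hK hc => ?_) fun n _ hx =>
    (differentiableOn_thetaTerm q n).differentiableAt (isOpen_compl_singleton.mem_nhds hx)
  obtain ⟨R, hR, h⟩ := exists_norm_le_and_norm_inv_le hK hc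
  exact ⟨_, summable_thetaBound (norm_pos_iff.2 hq0) hq hR, fun n x hx =>
    norm_thetaTerm_le hq0 hq (h x hx).1 (h x hx).2 n⟩

lemma differentiableOn_thetaSeries_mul {q : ℂ} (hq0 : q ≠ 0) (hq : ‖q‖ < 1) :
    DifferentiableOn ℂ (fun x => thetaSeries q (q * x)) {0}ᶜ :=
  (differentiableOn_thetaSeries hq0 hq).comp (by fun_prop) fun x hx => by simp_all

lemma differentiableOn_mul_div_sub {f g : ℂ → ℂ} {a : ℂ} (hf : DifferentiableOn ℂ f {0}ᶜ)
    (hg : DifferentiableOn ℂ g {0}ᶜ) (ha : a ≠ 0) (hfa : f a = 0) (hga : g a = 0) :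
    DifferentiableOn ℂ (fun x => f x * g x / (x - a)) {0}ᶜ := by
  have hd := (Complex.differentiableOn_dslope (isOpen_compl_singleton.mem_nhds ha)).2 hg
  refine (hf.mul hd).congr fun x _ => ?_
  rcases eq_or_ne x a with rfl | hxa
  · simp [hfa]
  · simp only [Pi.mul_apply]
    rw [dslope_of_ne _ hxa, slope_def_field, hga, sub_zero, mul_div_assoc]

lemma eventually_norm_inv_one_sub_mul_zpow_le {q : ℂ} (hq0 : q ≠ 0) (hq : ‖q‖ < 1) {R : ℝ}
    (hR : 0 < R) : ∀ᶠ n : ℤ in cofinite, ∀ x : ℂ, x ≠ 0 → ‖x‖ ≤ R → ‖x⁻¹‖ ≤ R →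
      ‖(1 - x * q ^ n)⁻¹‖ ≤ 2 := by
  have hρ : 0 < ‖q‖ := norm_pos_iff.2 hq0
  obtain ⟨N, hN⟩ := exists_pow_lt_of_lt_one (show 0 < 1 / (2 * R) by positivity) hq
  have hN' : R * ‖q‖ ^ N ≤ 1 / 2 := by
    rw [lt_div_iff₀ (by positivity)] at hN
    linarith
  rw [Int.cofinite_eq, eventually_sup]
  constructor
  · filter_upwards [eventually_le_atBot (-(N : ℤ))] with n hn x hx0 _ hx
    have h1 : (‖q‖ ^ N)⁻¹ ≤ ‖q‖ ^ n := by
      rw [← zpow_natCast, ← zpow_neg]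
      exact zpow_le_zpow_right_of_le_one₀ hρ hq.le hn
    have h2 : R⁻¹ ≤ ‖x‖ := by
      rw [norm_inv] at hx
      exact inv_le_of_inv_le₀ (norm_pos_iff.2 hx0) hx
    have h3 : 2 ≤ ‖x * q ^ n‖ := by
      rw [norm_mul, norm_zpow]
      calc (2 : ℝ) ≤ (R * ‖q‖ ^ N)⁻¹ := by
            rw [le_inv_comm₀ two_pos (by positivity)]; linarith
        _ = R⁻¹ * (‖q‖ ^ N)⁻¹ := mul_inv _ _
        _ ≤ _ := by gcongr
    rw [norm_inv]
    apply inv_le_of_inv_le₀ two_pos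
    have := norm_sub_norm_le (x * q ^ n) 1
    rw [norm_one, norm_sub_rev] at this
    linarith
  · filter_upwards [eventually_ge_atTop (N : ℤ)] with n hn x _ hx _
    have h1 : ‖q‖ ^ n ≤ ‖q‖ ^ N := by
      rw [← zpow_natCast]
      exact zpow_le_zpow_right_of_le_one₀ hρ hq.le hn
    have h3 : ‖x * q ^ n‖ ≤ 1 / 2 := by
      rw [norm_mul, norm_zpow]
      refine le_trans ?_ hN'
      gcongr
    rw [norm_inv]
    apply inv_le_of_inv_le₀ two_pos
    have := norm_sub_norm_le 1 (x * q ^ n)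
    rw [norm_one] at this
    linarith

lemma eventually_norm_inv_sub_zpow_le {q : ℂ} (hq0 : q ≠ 0) (hq : ‖q‖ < 1) {R : ℝ}
    (hR : 0 < R) : ∀ᶠ n : ℤ in cofinite, ∀ x : ℂ, x ≠ 0 → ‖x‖ ≤ R → ‖x⁻¹‖ ≤ R →
      ‖(x - q ^ (2 * n - 1))⁻¹‖ ≤ 2 * R := by
  have hinj : Function.Injective fun n : ℤ => 2 * n - 1 := fun a b h => by
    simp only at h; omega
  filter_upwards [hinj.tendsto_cofinite.eventually
    (eventually_norm_inv_one_sub_mul_zpow_le hq0 hq hR)] with n hn x hx h h'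
  have e : x - q ^ (2 * n - 1) = (1 - x⁻¹ * q ^ (2 * n - 1)) * x := by field_simp
  rw [e, mul_inv, norm_mul]
  gcongr
  exact hn x⁻¹ (inv_ne_zero hx) h' (by rwa [inv_inv])

/-- A function on the punctured plane invariant under multiplication by `p` is constant. -/
lemma eq_of_differentiableOn_of_mul_invariant {p : ℂ} (hp0 : p ≠ 0) (hp : ‖p‖ < 1) {g : ℂ → ℂ}
    (hg : DifferentiableOn ℂ g {0}ᶜ) (hinv : ∀ x, x ≠ 0 → g (p * x) = g x) {x y : ℂ}
    (hx : x ≠ 0) (hy : y ≠ 0) : g x = g y := by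
  have hρ : 0 < ‖p‖ := norm_pos_iff.2 hp0
  have hz : ∀ (n : ℤ) (x : ℂ), x ≠ 0 → g (p ^ n * x) = g x := by
    intro n x hx
    induction n using Int.induction_on with
    | zero => simp
    | succ n ih =>
      rw [zpow_add_one₀ hp0, mul_comm _ p, mul_assoc,
        hinv _ (mul_ne_zero (zpow_ne_zero _ hp0) hx), ih]
    | pred n ih =>
      rw [← hinv _ (mul_ne_zero (zpow_ne_zero _ hp0) hx), ← mul_assoc, ← zpow_one_add₀ hp0,
        add_sub_cancel, ih]
  set S : Set ℂ := Metric.closedBall 0 1 \ Metric.ball 0 ‖p‖ with hS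
  have hSc : IsCompact S := (isCompact_closedBall 0 1).diff Metric.isOpen_ball
  have hS0 : S ⊆ {0}ᶜ := fun x hx h0 => by
    rw [Set.mem_singleton_iff] at h0
    subst h0
    exact hx.2 (Metric.mem_ball_self hρ)
  obtain ⟨C, hC⟩ := hSc.exists_bound_of_continuousOn (hg.continuousOn.mono hS0)
  have hb : ∀ x, x ≠ 0 → ‖g x‖ ≤ C := fun x hx => by
    obtain ⟨n, hn1, hn2⟩ := exists_mem_Ico_zpow (norm_pos_iff.2 hx) ((one_lt_inv₀ hρ).2 hp)
    have hx' := norm_pos_iff.2 hx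
    have hn := zpow_pos hρ n
    rw [inv_zpow, inv_le_iff_one_le_mul₀ hn] at hn1
    rw [inv_zpow, lt_inv_comm₀ hx' (zpow_pos hρ _), ← one_div, lt_div_iff₀ hx'] at hn2
    rw [← hz (n + 1) x hx]
    apply hC
    rw [hS, Set.mem_sdiff, mem_closedBall_zero_iff, mem_ball_zero_iff, norm_mul, norm_zpow, not_lt]
    refine ⟨hn2.le, ?_⟩
    rw [zpow_add_one₀ hρ.ne']
    nlinarith
  have hd : Differentiable ℂ fun w => g (exp w) := fun w =>
    (hg.differentiableAt (isOpen_compl_singleton.mem_nhds (exp_ne_zero w))).comp w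
      differentiableAt_exp
  have h := hd.apply_eq_apply_of_bounded (isBounded_iff_forall_norm_le.2
    ⟨C, by rintro _ ⟨w, rfl⟩; exact hb _ (exp_ne_zero w)⟩) (log x) (log y)
  simpa only [exp_log hx, exp_log hy] using h

/-! ### The two Appell–Lerch type series -/

noncomputable def levelTwoAppell (q x : ℂ) : ℂ := ∑' n : ℤ, thetaTerm q (q ^ 2) n / (1 - x * q ^ n)

noncomputable def levelOneAppell (q x : ℂ) : ℂ :=
  ∑' n : ℤ, thetaTerm q x n / (x - q ^ (2 * n - 1))

lemma summable_levelTwoAppell {q x : ℂ} (hq0 : q ≠ 0) (hq : ‖q‖ < 1) (hx : x ≠ 0) :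
    Summable fun n : ℤ => thetaTerm q (q ^ 2) n / (1 - x * q ^ n) := by
  obtain ⟨R, hR, h⟩ := exists_norm_le_and_norm_inv_le (K := {x}) (by simpa using hx.symm) (by simp)
  refine ((summable_thetaTerm hq0 hq (pow_ne_zero 2 hq0)).norm.mul_right
    2).of_norm_bounded_eventually ?_
  filter_upwards [eventually_norm_inv_one_sub_mul_zpow_le hq0 hq hR] with n hn
  rw [div_eq_mul_inv, norm_mul]
  gcongr
  exact hn x hx (h x rfl).1 (h x rfl).2

lemma summable_levelOneAppell {q x : ℂ} (hq0 : q ≠ 0) (hq : ‖q‖ < 1) (hx : x ≠ 0) :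
    Summable fun n : ℤ => thetaTerm q x n / (x - q ^ (2 * n - 1)) := by
  obtain ⟨R, hR, h⟩ := exists_norm_le_and_norm_inv_le (K := {x}) (by simpa using hx.symm) (by simp)
  refine ((summable_thetaTerm hq0 hq hx).norm.mul_right (2 * R)).of_norm_bounded_eventually ?_
  filter_upwards [eventually_norm_inv_sub_zpow_le hq0 hq hR] with n hn
  rw [div_eq_mul_inv, norm_mul]
  gcongr
  exact hn x hx (h x rfl).1 (h x rfl).2

lemma levelTwoAppell_mul {q x : ℂ} (hq0 : q ≠ 0) (hq : ‖q‖ < 1) (hx : x ≠ 0)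
    (hxq : ∀ k : ℤ, x ≠ q ^ k) :
    levelTwoAppell q (q * x) = -x ^ 2 * levelTwoAppell q x - x * thetaSeries q q := by
  have e1 : levelTwoAppell q (q * x) = ∑' n : ℤ, -(thetaTerm q 1 n / (1 - x * q ^ n)) := by
    rw [levelTwoAppell,
      ← (Equiv.addRight (1 : ℤ)).tsum_eq (fun n => -(thetaTerm q 1 n / (1 - x * q ^ n)))]
    refine tsum_congr fun n => ?_
    have := thetaTerm_mul (q := q) (x := 1) (q ^ 2) n
    rw [mul_one] at this
    simp only [Equiv.coe_addRight]
    rw [thetaTerm_add_one hq0 one_ne_zero, this, zpow_add_one₀ hq0, zpow_mul, zpow_ofNat]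
    ring
  have h0 : thetaSeries q 1 = 0 := by simpa using thetaSeries_zpow_two_mul hq0 hq 0
  have h1 := summable_thetaTerm hq0 hq one_ne_zero
  have h2 := summable_levelTwoAppell hq0 hq hx
  have h3 := summable_thetaTerm hq0 hq hq0
  rw [e1, levelTwoAppell, ← sub_zero (_ - _), ← h0, thetaSeries, thetaSeries, ← tsum_mul_left,
    ← tsum_mul_left, ← (h2.mul_left _).tsum_sub (h3.mul_left _),
    ← ((h2.mul_left _).sub (h3.mul_left _)).tsum_sub h1]
  refine tsum_congr fun n => ?_
  have t2 := thetaTerm_mul (q := q) (x := 1) (q ^ 2) n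
  have t1 := thetaTerm_mul (q := q) (x := 1) q n
  rw [mul_one] at t1 t2
  have hn : 1 - x * q ^ n ≠ 0 := fun h => hxq (-n) (by
    rw [zpow_neg]; exact eq_inv_of_mul_eq_one_left (sub_eq_zero.1 h).symm)
  rw [t1, t2, pow_two q, mul_zpow]
  field_simp
  ring

lemma levelTwoAppell_sq_mul {q x : ℂ} (hq0 : q ≠ 0) (hq : ‖q‖ < 1) (hx : x ≠ 0)
    (hxq : ∀ k : ℤ, x ≠ q ^ k) :
    levelTwoAppell q (q ^ 2 * x) =
      q ^ 2 * x ^ 4 * levelTwoAppell q x + (q ^ 2 * x ^ 3 - q * x) * thetaSeries q q := by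
  have h : ∀ k : ℤ, q * x ≠ q ^ k := fun k hk => hxq (k - 1) (by
    rw [zpow_sub_one₀ hq0, ← hk]; field_simp)
  rw [pow_two q, mul_assoc, levelTwoAppell_mul hq0 hq (mul_ne_zero hq0 hx) h,
    levelTwoAppell_mul hq0 hq hx hxq]
  ring

lemma levelOneAppell_sq_mul {q x : ℂ} (hq0 : q ≠ 0) (hq : ‖q‖ < 1) (hx : x ≠ 0)
    (hxq : ∀ k : ℤ, x ≠ q ^ k) :
    levelOneAppell q (q ^ 2 * x) =
      -q ^ 2 * x ^ 3 * levelOneAppell q x + (q ^ 2 * x ^ 2 - q) * thetaSeries q x := by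
  have e : levelOneAppell q (q ^ 2 * x) =
      -q ^ 2 * x ^ 3 * levelOneAppell q x + q ^ 2 * x ^ 2 * thetaSeries q x +
        x * q * thetaSeries q (q ^ 2 * x) := by
    have h1 := summable_levelOneAppell hq0 hq hx
    have h2 := summable_thetaTerm hq0 hq hx
    have h3 := summable_thetaTerm hq0 hq (mul_ne_zero (pow_ne_zero 2 hq0) hx)
    rw [levelOneAppell, levelOneAppell, thetaSeries, thetaSeries, ← tsum_mul_left, ← tsum_mul_left,
      ← tsum_mul_left, ← (h1.mul_left _).tsum_add (h2.mul_left _),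
      ← ((h1.mul_left _).add (h2.mul_left _)).tsum_add (h3.mul_left _),
      ← (Equiv.addRight (1 : ℤ)).tsum_eq (fun n : ℤ => thetaTerm q (q ^ 2 * x) n / _)]
    refine tsum_congr fun n => ?_
    have hn : x - q ^ (2 * n - 1) ≠ 0 := sub_ne_zero.2 (hxq _)
    simp only [Equiv.coe_addRight]
    rw [thetaTerm_mul, thetaTerm_mul, thetaTerm_add_one hq0 hx, zpow_add_one₀ (pow_ne_zero 2 hq0),
      show 2 * (n + 1) - 1 = 2 * n - 1 + 2 by ring, zpow_add₀ hq0]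
    rw [zpow_ofNat, zpow_mul q, zpow_ofNat,
      show (q ^ 2) ^ n = q ^ (2 * n - 1) * q by
        rw [← zpow_add_one₀ hq0, sub_add_cancel, zpow_mul, zpow_ofNat],
      show q ^ 2 * x - q ^ (2 * n - 1) * q ^ 2 = q ^ 2 * (x - q ^ (2 * n - 1)) by ring]
    field_simp
    ring
  rw [e, thetaSeries_sq_mul hq0 hx]
  field_simp
  ring

lemma differentiableOn_mul_levelTwoAppell {q : ℂ} (hq0 : q ≠ 0) (hq : ‖q‖ < 1) {J : ℂ → ℂ}
    (hJ : DifferentiableOn ℂ J {0}ᶜ) (hJ0 : ∀ k : ℤ, J (q ^ k) = 0) :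
    DifferentiableOn ℂ (fun x => J x * J x * levelTwoAppell q x) {0}ᶜ := by
  simp_rw [levelTwoAppell, ← tsum_mul_left]
  refine SummableLocallyUniformlyOn.differentiableOn isOpen_compl_singleton
    (SummableLocallyUniformlyOn.of_locally_bounded_eventually isOpen_compl_singleton
      fun K hK hc => ?_) fun n x hx => ?_
  · obtain ⟨R, hR, h⟩ := exists_norm_le_and_norm_inv_le hK hc
    obtain ⟨C, hC⟩ := hc.exists_bound_of_continuousOn ((hJ.mul hJ).continuousOn.mono hK)
    refine ⟨_, ((summable_thetaTerm hq0 hq (pow_ne_zero 2 hq0)).norm.mul_right 2).mul_left C, ?_⟩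
    filter_upwards [eventually_norm_inv_one_sub_mul_zpow_le hq0 hq hR] with n hn x hx
    rw [norm_mul, div_eq_mul_inv, norm_mul (thetaTerm _ _ _)]
    gcongr
    · exact (norm_nonneg _).trans (hC x hx)
    · exact hC x hx
    · exact hn x (hK hx) (h x hx).1 (h x hx).2
  · have hd := (differentiableOn_mul_div_sub hJ hJ (zpow_ne_zero (-n) hq0) (hJ0 _)
      (hJ0 _)).const_mul (-q ^ (-n) * thetaTerm q (q ^ 2) n)
    refine (hd.congr fun y _ => ?_).differentiableAt (isOpen_compl_singleton.mem_nhds hx)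
    have hn := zpow_ne_zero n hq0
    rw [show 1 - y * q ^ n = (y - q ^ (-n)) * -q ^ n by rw [zpow_neg]; field_simp; ring,
      ← div_div, div_neg, zpow_neg]
    ring

lemma differentiableOn_mul_levelOneAppell {q : ℂ} (hq0 : q ≠ 0) (hq : ‖q‖ < 1) {J I : ℂ → ℂ}
    (hJ : DifferentiableOn ℂ J {0}ᶜ) (hJ0 : ∀ k : ℤ, J (q ^ (2 * k - 1)) = 0)
    (hI : DifferentiableOn ℂ I {0}ᶜ) (hI0 : ∀ k : ℤ, I (q ^ (2 * k - 1)) = 0) :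
    DifferentiableOn ℂ (fun x => J x * I x * levelOneAppell q x) {0}ᶜ := by
  simp_rw [levelOneAppell, ← tsum_mul_left]
  refine SummableLocallyUniformlyOn.differentiableOn isOpen_compl_singleton
    (SummableLocallyUniformlyOn.of_locally_bounded_eventually isOpen_compl_singleton
      fun K hK hc => ?_) fun n x hx => ?_
  · obtain ⟨R, hR, h⟩ := exists_norm_le_and_norm_inv_le hK hc
    obtain ⟨C, hC⟩ := hc.exists_bound_of_continuousOn ((hJ.mul hI).continuousOn.mono hK)
    refine ⟨_, ((summable_thetaBound (norm_pos_iff.2 hq0) hq hR).mul_right (2 * R)).mul_left C, ?_⟩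
    filter_upwards [eventually_norm_inv_sub_zpow_le hq0 hq hR] with n hn x hx
    have hT := norm_thetaTerm_le hq0 hq (h x hx).1 (h x hx).2 n
    rw [norm_mul, div_eq_mul_inv, norm_mul (thetaTerm _ _ _)]
    gcongr
    · exact (norm_nonneg _).trans (hC x hx)
    · exact hC x hx
    · exact (norm_nonneg _).trans hT
    · exact hn x (hK hx) (h x hx).1 (h x hx).2
  · have hd := (differentiableOn_thetaTerm q n).mul
      (differentiableOn_mul_div_sub hJ hI (zpow_ne_zero _ hq0) (hJ0 n) (hI0 n))
    refine (hd.congr fun y _ => ?_).differentiableAt (isOpen_compl_singleton.mem_nhds hx)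
    simp only [Pi.mul_apply]
    ring

lemma thetaSeries_mul_levelTwoAppell {q x : ℂ} (hq0 : q ≠ 0) (hq : ‖q‖ < 1) (hx : x ≠ 0)
    (hxq : ∀ k : ℤ, x ≠ q ^ k) :
    thetaSeries q x * levelTwoAppell q x + thetaSeries q q * levelOneAppell q x = 0 := by
  have hp0 : q ^ 2 ≠ 0 := pow_ne_zero _ hq0
  have hp : ‖q ^ 2‖ < 1 := by
    rw [norm_pow]; exact pow_lt_one₀ (norm_nonneg _) hq two_ne_zero
  set I : ℂ → ℂ := fun x => thetaSeries q (q * x) with hI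
  set J : ℂ → ℂ := fun x => thetaSeries q x * I x with hJ
  have hI0 : ∀ k : ℤ, I (q ^ (2 * k - 1)) = 0 := fun k => by
    simp only [hI]
    rw [← zpow_one_add₀ hq0, add_sub_cancel, thetaSeries_zpow_two_mul hq0 hq]
  have hJ0 : ∀ k : ℤ, J (q ^ k) = 0 := fun k => by
    simp only [hJ]
    obtain ⟨m, rfl | rfl⟩ : ∃ m, k = 2 * m ∨ k = 2 * m - 1 := ⟨(k + 1) / 2, by omega⟩
    · rw [thetaSeries_zpow_two_mul hq0 hq, zero_mul]
    · rw [hI0, mul_zero]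
  have hId := differentiableOn_thetaSeries_mul hq0 hq
  have hJd : DifferentiableOn ℂ J {0}ᶜ := (differentiableOn_thetaSeries hq0 hq).mul hId
  -- Multiplying by `J * I` clears all poles and makes the left-hand side `q²`-invariant.
  set K : ℂ → ℂ := fun x => J x * J x * levelTwoAppell q x +
    thetaSeries q q * (J x * I x * levelOneAppell q x) with hK
  have hKd : DifferentiableOn ℂ K {0}ᶜ :=
    (differentiableOn_mul_levelTwoAppell hq0 hq hJd hJ0).add
      ((differentiableOn_mul_levelOneAppell hq0 hq hJd (fun _ => hJ0 _) hId hI0).const_mul _)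
  have hK0 : ∀ k : ℤ, K (q ^ k) = 0 := fun k => by simp [hK, hJ0]
  have hinv : ∀ y, y ≠ 0 → K (q ^ 2 * y) = K y := by
    intro y hy
    by_cases h : ∀ k : ℤ, y ≠ q ^ k
    · simp only [hK, hJ, hI]
      rw [levelTwoAppell_sq_mul hq0 hq hy h, levelOneAppell_sq_mul hq0 hq hy h,
        show q * (q ^ 2 * y) = q ^ 2 * (q * y) by ring, thetaSeries_sq_mul hq0 hy,
        thetaSeries_sq_mul hq0 (mul_ne_zero hq0 hy)]
      field_simp
      ring
    · push Not at h
      obtain ⟨k, rfl⟩ := h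
      rw [hK0, ← zpow_natCast q 2, ← zpow_add₀ hq0, hK0]
  have h := eq_of_differentiableOn_of_mul_invariant hp0 hp hKd hinv hx (one_ne_zero)
  rw [← zpow_zero q, hK0] at h
  have hθ : thetaSeries q x ≠ 0 := thetaSeries_ne_zero hq0 hq hx fun m => hxq _
  have hIx : I x ≠ 0 := thetaSeries_ne_zero hq0 hq (mul_ne_zero hq0 hx) fun m hm =>
    hxq (2 * m - 1) (by rw [zpow_sub_one₀ hq0, ← hm]; field_simp)
  refine (mul_eq_zero.1 (?_ : (thetaSeries q x * I x * I x) * _ = 0)).resolve_left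
    (mul_ne_zero (mul_ne_zero hθ hIx) hIx)
  rw [← h]
  ring

theorem series_to_mAL (q x : ℂ) (hq0 : q ≠ 0) (hq : ‖q‖ < 1)
    (hx : x ≠ 0) (hxq : ∀ k : ℤ, x ≠ q ^ k) :
    (1 / jP q (q ^ 2)) * ∑' n : ℤ, ((-1 : ℂ) ^ n * q ^ (n ^ 2 + n)) / (1 - x * q ^ n) =
      -x⁻¹ * mAL (x ^ (-2 : ℤ) * q) (q ^ 2) x := by
  have hA : ∑' n : ℤ, ((-1 : ℂ) ^ n * q ^ (n ^ 2 + n)) / (1 - x * q ^ n) = levelTwoAppell q x := by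
    refine tsum_congr fun n => ?_
    rw [thetaTerm, mul_assoc, ← zpow_natCast q 2, ← zpow_mul, ← zpow_add₀ hq0]
    congr 3
    push_cast
    ring
  have hC : ∑' r : ℤ, ((-1 : ℂ) ^ r * (q ^ 2) ^ (r * (r - 1) / 2) * x ^ r) /
      (1 - (q ^ 2) ^ (r - 1) * (x ^ (-2 : ℤ) * q) * x) = x * levelOneAppell q x := by
    rw [levelOneAppell, ← tsum_mul_left]
    refine tsum_congr fun r => ?_
    have hr : 2 * (r * (r - 1) / 2) = r * (r - 1) :=
      Int.mul_ediv_cancel' (Int.even_mul_pred_self r).two_dvd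
    have hz : ∀ m : ℤ, (q ^ 2) ^ m = q ^ (2 * m) := fun m => by rw [zpow_mul, zpow_ofNat]
    have hd : x - q ^ (2 * r - 1) ≠ 0 := sub_ne_zero.2 (hxq _)
    have e : 1 - q ^ (2 * (r - 1)) * (x ^ (-2 : ℤ) * q) * x = (x - q ^ (2 * r - 1)) / x := by
      rw [show 2 * r - 1 = 2 * (r - 1) + 1 by ring, zpow_add_one₀ hq0, zpow_neg, zpow_ofNat]
      field_simp
    rw [hz, hz, hr, e, thetaTerm]
    field_simp
  have hθ : thetaSeries q x ≠ 0 := thetaSeries_ne_zero hq0 hq hx fun m => hxq _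
  have hθq : thetaSeries q q ≠ 0 := thetaSeries_ne_zero hq0 hq hq0 fun m hm => by
    have := zpow_right_injective₀ (norm_pos_iff.2 hq0) hq.ne
      (show ‖q‖ ^ (1 : ℤ) = ‖q‖ ^ (2 * m) by rw [← norm_zpow, ← norm_zpow, ← hm, zpow_one])
    omega
  have h := thetaSeries_mul_levelTwoAppell hq0 hq hx hxq
  rw [mAL, hA, hC, jP_eq_thetaSeries hq0 hq hq0, jP_eq_thetaSeries hq0 hq hx]
  field_simp
  linear_combination h
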